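/- arXiv:math/0411269 — 2 statements merged into one kernel-verified Lean document; each statement's English description precedes it below -/
import Mathlib

section
/- A quasi-Banach space X uniformly embeds into a (real, infinite-dimensional) Hilbert space if and only if it coarsely embeds into a Hilbert space. -/
open Filter Function

/-- A quasi-norm on a real vector space `X`: nonnegative, vanishing exactly at `0`,
absolutely homogeneous, and satisfying a `K`-relaxed triangle inequality for some `K ≥ 1`. -/
structure IsQuasiNorm {X : Type*} [AddCommGroup X] [Module ℝ X] (q : X → ℝ) : Prop where
  nonneg : ∀ x, 0 ≤ q x
  eq_zero_iff : ∀ x, q x = 0 ↔ x = 0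
  smul : ∀ (c : ℝ) (x : X), q (c • x) = |c| * q x
  exists_K : ∃ K : ℝ, 1 ≤ K ∧ ∀ x y, q (x + y) ≤ K * (q x + q y)

/-- Completeness of the metrizable linear topology induced by the quasi-norm,
stated sequentially: every Cauchy sequence converges. -/
def QuasiNormComplete {X : Type*} [AddCommGroup X] [Module ℝ X] (q : X → ℝ) : Prop :=
  ∀ u : ℕ → X, (∀ ε > 0, ∃ N, ∀ m ≥ N, ∀ n ≥ N, q (u m - u n) < ε) →
    ∃ x : X, Tendsto (fun n => q (u n - x)) atTop (nhds 0)

/-- A coarse embedding of a space with distance `d` into a (pseudo)metric space. -/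
def IsCoarseEmbedding {X : Type*} {H : Type*} [PseudoMetricSpace H]
    (d : X → X → ℝ) (f : X → H) : Prop :=
  ∃ φ₁ φ₂ : ℝ → ℝ, Monotone φ₁ ∧ Monotone φ₂ ∧ Tendsto φ₁ atTop atTop ∧
    ∀ x y, φ₁ (d x y) ≤ dist (f x) (f y) ∧ dist (f x) (f y) ≤ φ₂ (d x y)

/-- A bundled real, infinite-dimensional Hilbert space. -/
structure InfDimHilbertSpace where
  carrier : Type
  [grp : NormedAddCommGroup carrier]
  [ips : InnerProductSpace ℝ carrier]
  [cpl : CompleteSpace carrier]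
  infdim : ¬ FiniteDimensional ℝ carrier

attribute [instance] InfDimHilbertSpace.grp InfDimHilbertSpace.ips InfDimHilbertSpace.cpl

/-- `X` (with quasi-norm `q`) coarsely embeds into a real infinite-dimensional Hilbert space. -/
def CoarselyEmbedsIntoHilbert (X : Type*) [AddCommGroup X] [Module ℝ X] (q : X → ℝ) : Prop :=
  ∃ (H : InfDimHilbertSpace) (f : X → H.carrier),
    IsCoarseEmbedding (fun x y => q (x - y)) f

/-- A uniform embedding of a space with distance `d` into a (pseudo)metric space:
an injective map which is uniformly continuous together with its inverse on the image. -/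
def IsUniformEmbeddingMap {X : Type*} {H : Type*} [PseudoMetricSpace H]
    (d : X → X → ℝ) (f : X → H) : Prop :=
  Function.Injective f ∧
  (∀ ε > 0, ∃ δ > 0, ∀ x y, d x y < δ → dist (f x) (f y) < ε) ∧
  (∀ ε > 0, ∃ δ > 0, ∀ x y, dist (f x) (f y) < δ → d x y < ε)

/-- `X` (with quasi-norm `q`) uniformly embeds into a real infinite-dimensional Hilbert
space. -/
def UniformlyEmbedsIntoHilbert (X : Type*) [AddCommGroup X] [Module ℝ X] (q : X → ℝ) : Prop :=
  ∃ (H : InfDimHilbertSpace) (f : X → H.carrier),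
    IsUniformEmbeddingMap (fun x y => q (x - y)) f

universe u

theorem posSemidef_of_inner {ι E : Type*} [NormedAddCommGroup E] [InnerProductSpace ℝ E]
    (v : ι → E) : (Matrix.of fun i j => inner ℝ (v i) (v j)).PosSemidef := by
  refine ⟨Matrix.ext fun i j => by simp [real_inner_comm], fun c => ?_⟩
  have h : (c.sum fun i ci => c.sum fun j cj => star ci * inner ℝ (v i) (v j) * cj) =
      inner ℝ (c.sum fun i ci => ci • v i) (c.sum fun i ci => ci • v i) := by
    simp only [Finsupp.sum, sum_inner]
    refine Finset.sum_congr rfl fun i _ => ?_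
    rw [inner_sum]
    refine Finset.sum_congr rfl fun j _ => ?_
    rw [inner_smul_left, inner_smul_right, star_trivial, conj_trivial]
    ring
  simpa only [Matrix.of_apply, h] using real_inner_self_nonneg

theorem posSemidef_inner_pow {E : Type*} [NormedAddCommGroup E] [InnerProductSpace ℝ E] (n : ℕ) :
    (Matrix.of fun u v : E => (inner ℝ u v) ^ n).PosSemidef := by
  induction n with
  | zero => simpa using posSemidef_of_inner (fun _ : E => (1 : ℝ))
  | succ n ih =>
    have h := ih.hadamard (posSemidef_of_inner (id : E → E))
    have heq : (Matrix.of fun u v : E => (inner ℝ u v) ^ (n + 1)) =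
        (Matrix.of fun u v : E => (inner ℝ u v) ^ n).hadamard
          (Matrix.of fun u v : E => inner ℝ (id u) (id v)) := by
      ext u v
      simp [pow_succ]
    rw [heq]
    exact h

theorem posSemidef_exp_inner {E : Type*} [NormedAddCommGroup E] [InnerProductSpace ℝ E] :
    (Matrix.of fun u v : E => Real.exp (inner ℝ u v)).PosSemidef := by
  refine ⟨Matrix.ext fun i j => by simp [real_inner_comm], fun c => ?_⟩
  have hs : HasSum (fun n : ℕ => (n.factorial : ℝ)⁻¹ * c.sum fun i ci => c.sum fun j cj =>
      star ci * (inner ℝ i j) ^ n * cj)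
      (c.sum fun i ci => c.sum fun j cj => star ci * Real.exp (inner ℝ i j) * cj) := by
    simp only [Finsupp.sum, Finset.mul_sum]
    refine hasSum_sum fun i _ => hasSum_sum fun j _ => ?_
    have h := NormedSpace.expSeries_div_hasSum_exp (𝔸 := ℝ) (inner ℝ i j : ℝ)
    rw [← Real.exp_eq_exp_ℝ] at h
    rw [show (fun n : ℕ => (n.factorial : ℝ)⁻¹ * (star (c i) * inner ℝ i j ^ n * c j)) =
        fun n => star (c i) * (inner ℝ i j ^ n / n.factorial) * c j by ext n; ring]
    exact (h.mul_left (star (c i))).mul_right (c j)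
  exact hs.nonneg fun n => mul_nonneg (by positivity) ((posSemidef_inner_pow n).2 c)

/-- The Gaussian kernel on a real inner product space is positive semidefinite. -/
theorem posSemidef_gaussian {E : Type*} [NormedAddCommGroup E] [InnerProductSpace ℝ E] :
    (Matrix.of fun u v : E => Real.exp (-(‖u - v‖ ^ 2 / 2))).PosSemidef := by
  have heq : (Matrix.of fun u v : E => Real.exp (-(‖u - v‖ ^ 2 / 2))) =
      (Matrix.of fun u v : E => Real.exp (inner ℝ u v)).hadamard (Matrix.of fun u v : E =>
        inner ℝ (Real.exp (-(‖u‖ ^ 2 / 2))) (Real.exp (-(‖v‖ ^ 2 / 2)))) := by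
    ext u v
    simp only [Matrix.of_apply, Matrix.hadamard_apply, RCLike.inner_apply, conj_trivial,
      ← Real.exp_add, norm_sub_sq_real]
    ring_nf
  rw [heq]
  exact posSemidef_exp_inner.hadamard (posSemidef_of_inner _)

/-- A real positive semidefinite kernel is the Gram kernel of vectors in a Hilbert space. -/
theorem exists_inner_eq_of_posSemidef {α : Type u} (K : Matrix α α ℝ) (hK : K.PosSemidef) :
    ∃ (H : Type u) (_ : NormedAddCommGroup H) (_ : InnerProductSpace ℝ H) (_ : CompleteSpace H)
      (Φ : α → H), ∀ x y, inner ℝ (Φ x) (Φ y) = K x y := by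
  let T : Matrix α α (ℝ →L[ℝ] ℝ) := Matrix.of fun x y => K x y • (1 : ℝ →L[ℝ] ℝ)
  have hsymm (x y : α) : K x y = K y x := by simpa using hK.1.apply y x
  have hT : T.PosSemidef := by
    have htfae := (RKHS.posSemidef_tfae (K := T)).out 0 2
    refine htfae.2 ⟨?_, fun c => ?_⟩
    · ext x y
      simp [T, Matrix.conjTranspose_apply, hsymm x y]
    · refine (hK.2 c).trans_eq ?_
      simp only [Finsupp.sum, T, RCLike.re_to_real]
      refine Finset.sum_congr rfl fun i _ => Finset.sum_congr rfl fun j _ => ?_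
      simp [hsymm j i]
      ring
  have : Fact T.PosSemidef := ⟨hT⟩
  refine ⟨RKHS.OfKernel T, inferInstance, inferInstance, inferInstance,
    fun x => RKHS.kerFun (RKHS.OfKernel T) x 1, fun x y => ?_⟩
  rw [← RKHS.kernel_inner, RKHS.OfKernel.kernel_ofKernel]
  simp [T, hsymm y x]

/-- A map from a Hilbert space to a Hilbert space whose kernel is the Gaussian kernel. -/
theorem exists_gaussian_map (E : Type u) [NormedAddCommGroup E] [InnerProductSpace ℝ E] :
    ∃ (H : Type u) (_ : NormedAddCommGroup H) (_ : InnerProductSpace ℝ H) (_ : CompleteSpace H)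
      (Φ : E → H), ∀ u v, ‖Φ u - Φ v‖ ^ 2 = 2 * (1 - Real.exp (-(‖u - v‖ ^ 2 / 2))) := by
  obtain ⟨H, _, _, _, Φ, hΦ⟩ := exists_inner_eq_of_posSemidef _ (posSemidef_gaussian (E := E))
  refine ⟨H, ‹_›, ‹_›, ‹_›, Φ, fun u v => ?_⟩
  rw [norm_sub_sq_real, ← real_inner_self_eq_norm_sq, ← real_inner_self_eq_norm_sq, hΦ, hΦ, hΦ]
  simp
  ring

/-- Finitely many balls in a real inner product space whose centers satisfy
`‖yᵢ - yⱼ‖² ≤ rᵢ + rⱼ` and whose squared radii are the `rᵢ` have a common point. -/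
theorem exists_forall_norm_sub_sq_le_of_fintype {ι E : Type*} [Fintype ι] [NormedAddCommGroup E]
    [InnerProductSpace ℝ E] (y : ι → E) (r : ι → ℝ)
    (h : ∀ i j, ‖y i - y j‖ ^ 2 ≤ r i + r j) : ∃ z, ∀ i, ‖z - y i‖ ^ 2 ≤ r i := by
  classical
  rcases isEmpty_or_nonempty ι with hι | ⟨⟨i₀⟩⟩
  · exact ⟨0, fun i => isEmptyElim i⟩
  let L : (ι → ℝ) → ℝ := fun w => ∑ i, w i * (‖y i‖ ^ 2 - r i)
  let c : (ι → ℝ) → E := fun w => ∑ i, w i • y i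
  obtain ⟨w, hw, hmax⟩ := (isCompact_stdSimplex ℝ ι).exists_isMaxOn
    ⟨_, single_mem_stdSimplex ℝ i₀⟩
    (f := fun w => L w - ‖c w‖ ^ 2) (by fun_prop)
  have hsum : ∑ i, w i = 1 := hw.2
  have key : L w - ‖c w‖ ^ 2 ≤ 0 := by
    have h1 : ∑ i, ∑ j, w i * w j * ‖y i - y j‖ ^ 2 =
        2 * ∑ i, w i * ‖y i‖ ^ 2 - 2 * ‖c w‖ ^ 2 := by
      have hc : ‖c w‖ ^ 2 = ∑ i, ∑ j, w i * w j * inner ℝ (y i) (y j) := by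
        rw [← real_inner_self_eq_norm_sq, sum_inner]
        refine Finset.sum_congr rfl fun i _ => ?_
        rw [inner_sum]
        refine Finset.sum_congr rfl fun j _ => ?_
        rw [inner_smul_left, inner_smul_right, conj_trivial]
        ring
      have ha : ∑ i, ∑ j, w i * w j * ‖y i‖ ^ 2 = ∑ i, w i * ‖y i‖ ^ 2 := by
        refine Finset.sum_congr rfl fun i _ => ?_
        rw [← Finset.sum_mul, ← Finset.mul_sum, hsum, mul_one]
      have hb : ∑ i, ∑ j, w i * w j * ‖y j‖ ^ 2 = ∑ i, w i * ‖y i‖ ^ 2 := by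
        rw [Finset.sum_comm, ← ha]
        exact Finset.sum_congr rfl fun i _ => Finset.sum_congr rfl fun j _ => by ring
      rw [hc, two_mul (∑ i, w i * ‖y i‖ ^ 2)]
      nth_rw 1 [← ha]
      rw [← hb]
      simp only [Finset.mul_sum, ← Finset.sum_add_distrib, ← Finset.sum_sub_distrib]
      refine Finset.sum_congr rfl fun i _ => Finset.sum_congr rfl fun j _ => ?_
      rw [norm_sub_sq_real]
      ring
    have h2 : ∑ i, ∑ j, w i * w j * ‖y i - y j‖ ^ 2 ≤ 2 * ∑ i, w i * r i := by
      have ha : ∑ i, ∑ j, w i * w j * r i = ∑ i, w i * r i := by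
        refine Finset.sum_congr rfl fun i _ => ?_
        rw [← Finset.sum_mul, ← Finset.mul_sum, hsum, mul_one]
      have hb : ∑ i, ∑ j, w i * w j * r j = ∑ i, w i * r i := by
        rw [Finset.sum_comm, ← ha]
        exact Finset.sum_congr rfl fun i _ => Finset.sum_congr rfl fun j _ => by ring
      rw [two_mul]
      nth_rw 1 [← ha]
      rw [← hb]
      simp only [← Finset.sum_add_distrib]
      refine Finset.sum_le_sum fun i _ => Finset.sum_le_sum fun j _ => ?_
      rw [← mul_add]
      exact mul_le_mul_of_nonneg_left (h i j) (mul_nonneg (hw.1 i) (hw.1 j))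
    have h3 : L w = ∑ i, w i * ‖y i‖ ^ 2 - ∑ i, w i * r i := by
      simp only [L, mul_sub, Finset.sum_sub_distrib]
    linarith
  refine ⟨c w, fun i => ?_⟩
  set A : ℝ := (‖y i‖ ^ 2 - r i) - L w - 2 * inner ℝ (c w) (y i - c w) with hA
  have hstep : ∀ s : ℝ, 0 < s → s ≤ 1 → A ≤ s * ‖y i - c w‖ ^ 2 := by
    intro s hs0 hs1
    let w' : ι → ℝ := (1 - s) • w + s • Pi.single i 1
    have hw' : w' ∈ stdSimplex ℝ ι :=
      convex_stdSimplex ℝ ι hw (single_mem_stdSimplex ℝ i) (by linarith) hs0.le (by ring)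
    have hL : L w' = L w + s * ((‖y i‖ ^ 2 - r i) - L w) := by
      simp only [L, w', Pi.add_apply, Pi.smul_apply, smul_eq_mul, add_mul, Finset.sum_add_distrib,
        mul_assoc, ← Finset.mul_sum]
      simp [Pi.single_apply]
      ring
    have hc : c w' = c w + s • (y i - c w) := by
      simp only [c, w', Pi.add_apply, Pi.smul_apply, smul_eq_mul, add_smul, Finset.sum_add_distrib,
        mul_smul, ← Finset.smul_sum]
      simp [Pi.single_apply]
      module
    have hle : L w' - ‖c w'‖ ^ 2 ≤ L w - ‖c w‖ ^ 2 := hmax hw'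
    rw [hL, hc, norm_add_sq_real, inner_smul_right, norm_smul, mul_pow, Real.norm_eq_abs,
      sq_abs] at hle
    have : s * A ≤ s * (s * ‖y i - c w‖ ^ 2) := by rw [hA]; linarith
    exact le_of_mul_le_mul_left this hs0
  have hA0 : A ≤ 0 := by
    have ht : Tendsto (fun s : ℝ => s * ‖y i - c w‖ ^ 2) (nhdsWithin 0 (Set.Ioi 0)) (nhds 0) := by
      have : Continuous fun s : ℝ => s * ‖y i - c w‖ ^ 2 := by fun_prop
      simpa using (this.tendsto 0).mono_left nhdsWithin_le_nhds
    refine ge_of_tendsto ht ?_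
    filter_upwards [Ioc_mem_nhdsGT (zero_lt_one' ℝ)] with s hs using hstep s hs.1 hs.2
  rw [inner_sub_right, real_inner_self_eq_norm_sq] at hA
  rw [norm_sub_sq_real]
  linarith

theorem exists_forall_norm_sub_sq_le {ι E : Type*} [NormedAddCommGroup E]
    [InnerProductSpace ℝ E] [CompleteSpace E] (y : ι → E) (r : ι → ℝ)
    (h : ∀ i j, ‖y i - y j‖ ^ 2 ≤ r i + r j) : ∃ z, ∀ i, ‖z - y i‖ ^ 2 ≤ r i := by
  classical
  rcases isEmpty_or_nonempty ι with hι | ⟨⟨i₀⟩⟩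
  · exact ⟨0, fun i => isEmptyElim i⟩
  have hr (i : ι) : 0 ≤ r i := by simpa using h i i
  let B : ι → Set (WeakDual ℝ E) := fun i =>
    WeakDual.toStrongDual ⁻¹' Metric.closedBall (InnerProductSpace.toDual ℝ E (y i)) √(r i)
  have hB (z : E) (i : ι) : StrongDual.toWeakDual (InnerProductSpace.toDual ℝ E z) ∈ B i ↔
      ‖z - y i‖ ^ 2 ≤ r i := by
    rw [Set.mem_preimage, Metric.mem_closedBall, ← Real.le_sqrt (norm_nonneg _) (hr i)]
    change dist (InnerProductSpace.toDual ℝ E z) (InnerProductSpace.toDual ℝ E (y i)) ≤ _ ↔ _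
    rw [LinearIsometryEquiv.dist_map, dist_eq_norm]
  obtain ⟨ℓ, -, hℓ⟩ := (WeakDual.isCompact_closedBall
    (InnerProductSpace.toDual ℝ E (y i₀)) √(r i₀)).inter_iInter_nonempty B
    (fun i => WeakDual.isClosed_closedBall _ _) fun s => by
      obtain ⟨z, hz⟩ := exists_forall_norm_sub_sq_le_of_fintype
        (fun i : (insert i₀ s : Finset ι) => y i) (fun i => r i) fun i j => h i j
      exact ⟨_, (hB z i₀).2 (hz ⟨i₀, by simp⟩),
        Set.mem_iInter₂.2 fun i hi => (hB z i).2 (hz ⟨i, by simp [hi]⟩)⟩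
  refine ⟨(InnerProductSpace.toDual ℝ E).symm (WeakDual.toStrongDual ℓ), fun i => (hB _ i).1 ?_⟩
  rw [LinearIsometryEquiv.apply_symm_apply]
  exact Set.mem_iInter.1 hℓ i

/-- **Minty's extension theorem**: a Hilbert space valued map on a subset of a metric space which
is Hölder of exponent `1 / 2` extends to the whole space with the same constant. -/
theorem exists_holder_half_extension {X E : Type*} [PseudoMetricSpace X] [NormedAddCommGroup E]
    [InnerProductSpace ℝ E] [CompleteSpace E] {C : ℝ} (hC : 0 ≤ C) (A : Set X) (f : X → E)
    (hf : ∀ a ∈ A, ∀ b ∈ A, ‖f a - f b‖ ^ 2 ≤ C * dist a b) :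
    ∃ g : X → E, (∀ a ∈ A, g a = f a) ∧ ∀ x y, ‖g x - g y‖ ^ 2 ≤ C * dist x y := by
  let S : Set (Set (X × E)) := {G | ∀ p ∈ G, ∀ p' ∈ G, ‖p.2 - p'.2‖ ^ 2 ≤ C * dist p.1 p'.1}
  have hS : (fun a => (a, f a)) '' A ∈ S := by
    rintro _ ⟨a, ha, rfl⟩ _ ⟨b, hb, rfl⟩
    exact hf a ha b hb
  obtain ⟨G, hAG, hG⟩ := zorn_subset_nonempty S (fun c hc hchain _ =>
    ⟨⋃₀ c, fun p ⟨s, hs, hp⟩ p' ⟨s', hs', hp'⟩ => by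
      rcases hchain.total hs hs' with hss | hss
      · exact hc hs' p (hss hp) p' hp'
      · exact hc hs p hp p' (hss hp'), fun s hs => Set.subset_sUnion_of_mem hs⟩) _ hS
  have htotal : ∀ x, ∃ e, (x, e) ∈ G := by
    intro x
    obtain ⟨z, hz⟩ := exists_forall_norm_sub_sq_le (fun p : G => p.1.2)
      (fun p : G => C * dist x p.1.1) fun p p' => (hG.prop _ p.2 _ p'.2).trans <| by
        rw [← mul_add]
        exact mul_le_mul_of_nonneg_left (dist_triangle_left _ _ _) hC
    refine ⟨z, hG.mem_of_prop_insert ?_⟩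
    rintro p (rfl | hp) p' (rfl | hp')
    · simp
    · exact hz ⟨p', hp'⟩
    · rw [norm_sub_rev, dist_comm]
      exact hz ⟨p, hp⟩
    · exact hG.prop _ hp _ hp'
  choose g hg using htotal
  refine ⟨g, fun a ha => ?_, fun x y => hG.prop _ (hg x) _ (hg y)⟩
  have h := hG.prop _ (hg a) _ (hAG ⟨a, ha, rfl⟩)
  simpa [sub_eq_zero] using h

theorem exists_separated_net (X : Type*) [PseudoMetricSpace X] :
    ∃ A : Set X, (∀ a ∈ A, ∀ b ∈ A, a ≠ b → 1 ≤ dist a b) ∧ ∀ x, ∃ a ∈ A, dist x a ≤ 1 := by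
  let S : Set (Set X) := {A | ∀ a ∈ A, ∀ b ∈ A, a ≠ b → 1 ≤ dist a b}
  obtain ⟨A, -, hA⟩ := zorn_subset_nonempty S (fun c hc hchain _ =>
    ⟨⋃₀ c, fun a ⟨s, hs, ha⟩ b ⟨t, ht, hb⟩ => by
      rcases hchain.total hs ht with hst | hst
      · exact hc ht a (hst ha) b hb
      · exact hc hs a ha b (hst hb), fun s hs => Set.subset_sUnion_of_mem hs⟩) ∅ (by simp [S])
  refine ⟨A, hA.prop, fun x => ?_⟩
  by_contra! hx
  have hxA : x ∈ A := by
    refine hA.mem_of_prop_insert ?_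
    rintro a (rfl | ha) b (rfl | hb) hab
    · exact absurd rfl hab
    · exact (hx b hb).le
    · exact dist_comm a b ▸ (hx a ha).le
    · exact hA.prop a ha b hb hab
  have := hx x hxA
  simp only [dist_self] at this
  linarith

/-- A coarse embedding of a metric space into a Hilbert space can be replaced by a map which is
Hölder of exponent `1 / 2` and keeps points that are far apart at distance at least `1 / 2`. -/
theorem exists_holder_half_of_coarse {X : Type*} {E : Type u} [PseudoMetricSpace X]
    [NormedAddCommGroup E] [InnerProductSpace ℝ E] (f : X → E)
    (hup : ∀ R, ∃ S, ∀ x y, dist x y ≤ R → ‖f x - f y‖ ≤ S)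
    (hlow : ∀ S, ∃ R, ∀ x y, R ≤ dist x y → S ≤ ‖f x - f y‖) :
    ∃ (H : Type u) (_ : NormedAddCommGroup H) (_ : InnerProductSpace ℝ H) (_ : CompleteSpace H)
      (g : X → H), (∀ x y, ‖g x - g y‖ ^ 2 ≤ 1 / 16 * dist x y) ∧
        ∃ R, ∀ x y, R ≤ dist x y → 1 / 2 ≤ ‖g x - g y‖ := by
  obtain ⟨H, _, _, _, Φ, hΦ⟩ := exists_gaussian_map E
  obtain ⟨A, hsep, hnet⟩ := exists_separated_net X
  obtain ⟨S, hS⟩ := hup 32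
  obtain ⟨t, ht0, ht⟩ : ∃ t : ℝ, 0 < t ∧ t ^ 2 * S ^ 2 ≤ 1 / 16 := by
    refine ⟨1 / (4 * (|S| + 1)), by positivity, ?_⟩
    rw [← mul_pow, div_mul_eq_mul_div, one_mul, div_pow, div_le_iff₀ (by positivity), ← sq_abs S]
    nlinarith [abs_nonneg S]
  have hh (x y : X) : ‖Φ (t • f x) - Φ (t • f y)‖ ^ 2 =
      2 * (1 - Real.exp (-(t ^ 2 * ‖f x - f y‖ ^ 2 / 2))) := by
    rw [hΦ, ← smul_sub, norm_smul, mul_pow, Real.norm_eq_abs, sq_abs]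
  obtain ⟨g, hgA, hg⟩ := exists_holder_half_extension (C := 1 / 16) (by norm_num) A
    (fun x => Φ (t • f x)) fun a ha b hb => by
      rcases eq_or_ne a b with rfl | hab
      · simp
      rw [hh]
      rcases le_total (dist a b) 32 with hd | hd
      · have h1 := hsep a ha b hb hab
        have h2 : ‖f a - f b‖ ^ 2 ≤ S ^ 2 := by
          gcongr
          exact hS a b hd
        have h3 := Real.add_one_le_exp (-(t ^ 2 * ‖f a - f b‖ ^ 2 / 2))
        have h4 : t ^ 2 * ‖f a - f b‖ ^ 2 ≤ t ^ 2 * S ^ 2 := by gcongr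
        linarith
      · linarith [Real.exp_pos (-(t ^ 2 * ‖f a - f b‖ ^ 2 / 2))]
  obtain ⟨R, hR⟩ := hlow (2 / t)
  refine ⟨H, ‹_›, ‹_›, ‹_›, g, hg, R + 2, fun x y hxy => ?_⟩
  obtain ⟨a, ha, hxa⟩ := hnet x
  obtain ⟨b, hb, hyb⟩ := hnet y
  have hdist : R ≤ dist a b := by
    linarith [dist_triangle4 x a b y, dist_comm b y]
  have hfar : 1 ≤ ‖g a - g b‖ := by
    have h1 : 2 ≤ t * ‖f a - f b‖ := by
      rw [mul_comm]
      exact (div_le_iff₀ ht0).1 (hR a b hdist)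
    have h2 : 1 ≤ t ^ 2 * ‖f a - f b‖ ^ 2 / 2 := by nlinarith
    have h3 : Real.exp (-(t ^ 2 * ‖f a - f b‖ ^ 2 / 2)) ≤ 1 / 2 := by
      rw [Real.exp_neg, one_div]
      exact inv_anti₀ two_pos (by linarith [Real.add_one_le_exp (t ^ 2 * ‖f a - f b‖ ^ 2 / 2)])
    rw [hgA a ha, hgA b hb, ← one_le_sq_iff₀ (norm_nonneg _), hh]
    linarith
  have hnear {x a : X} (hxa : dist x a ≤ 1) : ‖g x - g a‖ ≤ 1 / 4 := by
    refine (sq_le_sq₀ (norm_nonneg _) (by norm_num)).1 ?_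
    linarith [hg x a]
  have h1 := hnear hxa
  have h2 := hnear hyb
  have h3 : ‖g a - g b‖ ≤ ‖g x - g a‖ + ‖g x - g y‖ + ‖g y - g b‖ := by
    simpa only [dist_eq_norm, norm_sub_rev (g a) (g x)] using dist_triangle4 (g a) (g x) (g y) (g b)
  linarith

/-- Countably many maps into a Hilbert space with square summable displacements combine into a
single map into the `ℓ²`-sum. -/
theorem exists_lp_map {X E : Type*} [NormedAddCommGroup E] (F : ℕ → X → E)
    (hF : ∀ x y, Summable fun n => ‖F n x - F n y‖ ^ 2) :
    ∃ G : X → lp (fun _ : ℕ => E) 2,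
      ∀ x y, HasSum (fun n => ‖F n x - F n y‖ ^ 2) (‖G x - G y‖ ^ 2) := by
  rcases isEmpty_or_nonempty X with hX | ⟨⟨x₀⟩⟩
  · exact ⟨isEmptyElim, isEmptyElim⟩
  let G : X → lp (fun _ : ℕ => E) 2 := fun x =>
    ⟨fun n => F n x - F n x₀, memℓp_gen (by simpa using hF x x₀)⟩
  refine ⟨G, fun x y => ?_⟩
  have h := lp.hasSum_norm (p := 2) (by simp) (G x - G y)
  have hG (n : ℕ) : (G x - G y : lp (fun _ : ℕ => E) 2) n = F n x - F n y := by
    rw [lp.coeFn_sub, Pi.sub_apply]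
    exact sub_sub_sub_cancel_right _ _ _
  simp only [hG, ENNReal.toReal_ofNat, Real.rpow_ofNat] at h
  exact h

theorem not_finiteDimensional_lp (E : Type*) [NormedAddCommGroup E] [InnerProductSpace ℝ E]
    [Nontrivial E] : ¬ FiniteDimensional ℝ (lp (fun _ : ℕ => E) 2) := by
  intro hfin
  obtain ⟨e, he⟩ := exists_norm_eq E zero_le_one
  have ho : Orthonormal ℝ fun n : ℕ => (lp.single 2 n e : lp (fun _ : ℕ => E) 2) := by
    refine ⟨fun n => by rw [lp.norm_single (by norm_num), he], fun m n hmn => ?_⟩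
    change inner ℝ (lp.single 2 m e : lp (fun _ : ℕ => E) 2) (lp.single 2 n e) = 0
    rw [lp.inner_single_left, lp.single_apply_ne _ _ _ hmn, inner_zero_right]
  exact not_finite_iff_infinite.2 (inferInstance : Infinite ℕ) ho.linearIndependent.finite

theorem exists_pseudoMetric_of_isQuasiNorm {X : Type*} [AddCommGroup X] [Module ℝ X] {q : X → ℝ}
    (hq : IsQuasiNorm q) : ∃ p : ℝ, 0 < p ∧ p ≤ 1 ∧ ∃ _ : PseudoMetricSpace X,
      ∀ x y, dist x y ≤ q (x - y) ^ p ∧ q (x - y) ^ p ≤ 2 * dist x y := by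
  obtain ⟨K, hK1, hK⟩ := hq.exists_K
  have hL : 3 ≤ 3 * K ^ 2 := by nlinarith
  set p := Real.logb (3 * K ^ 2) 2 with hp
  have hp0 : 0 < p := Real.logb_pos (by linarith) (by norm_num)
  have hp1 : p ≤ 1 := by
    rw [hp, Real.logb_le_iff_le_rpow (by linarith) (by norm_num), Real.rpow_one]
    linarith
  have hpow : (3 * K ^ 2) ^ p = 2 :=
    Real.rpow_logb (by linarith) (by linarith) (by norm_num)
  have hneg (x : X) : q (-x) = q x := by simpa using hq.smul (-1) x
  let d : X → X → NNReal := fun x y => (q (x - y)).toNNReal ^ p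
  have hd (x y : X) : (d x y : ℝ) = q (x - y) ^ p := by simp [d, hq.nonneg]
  have hself (x : X) : d x x = 0 := by
    ext
    simp [hd, (hq.eq_zero_iff 0).2 rfl, hp0.ne']
  have hcomm (x y : X) : d x y = d y x := by
    ext
    rw [hd, hd, ← hneg, neg_sub]
  have htri (x₁ x₂ x₃ x₄ : X) :
      d x₁ x₄ ≤ 2 * max (d x₁ x₂) (max (d x₂ x₃) (d x₃ x₄)) := by
    set M := max (q (x₁ - x₂)) (max (q (x₂ - x₃)) (q (x₃ - x₄))) with hM
    have hM0 : 0 ≤ M := (hq.nonneg _).trans (le_max_left _ _)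
    have h1 : q (x₁ - x₂) ≤ M := le_max_left _ _
    have h2 : q (x₂ - x₃) ≤ M := (le_max_left _ _).trans (le_max_right _ _)
    have h3 : q (x₃ - x₄) ≤ M := (le_max_right _ _).trans (le_max_right _ _)
    have h4 : q (x₂ - x₄) ≤ K * (2 * M) := by
      have := hK (x₂ - x₃) (x₃ - x₄)
      rw [sub_add_sub_cancel] at this
      exact this.trans (mul_le_mul_of_nonneg_left (by linarith) (by linarith))
    have h5 : q (x₁ - x₄) ≤ 3 * K ^ 2 * M := by
      have := hK (x₁ - x₂) (x₂ - x₄)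
      rw [sub_add_sub_cancel] at this
      have h6 : K * (q (x₁ - x₂) + q (x₂ - x₄)) ≤ K * (K * M + K * (2 * M)) :=
        mul_le_mul_of_nonneg_left (add_le_add (h1.trans (le_mul_of_one_le_left hM0 hK1)) h4)
          (by linarith)
      linarith
    have h6 : q (x₁ - x₄) ^ p ≤ 2 * M ^ p := by
      rw [← hpow, ← Real.mul_rpow (by positivity) hM0]
      exact Real.rpow_le_rpow (hq.nonneg _) h5 hp0.le
    have h7 : M ^ p ≤ ((max (d x₁ x₂) (max (d x₂ x₃) (d x₃ x₄)) : NNReal) : ℝ) := by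
      rw [NNReal.coe_max, NNReal.coe_max, hd, hd, hd, hM]
      rcases max_choice (q (x₁ - x₂)) (max (q (x₂ - x₃)) (q (x₃ - x₄))) with h | h <;> rw [h]
      · exact le_max_left _ _
      · refine le_max_of_le_right ?_
        rcases max_choice (q (x₂ - x₃)) (q (x₃ - x₄)) with h | h <;> rw [h]
        · exact le_max_left _ _
        · exact le_max_right _ _
    rw [← NNReal.coe_le_coe, hd]
    push_cast at h7 ⊢
    linarith
  exact ⟨p, hp0, hp1, PseudoMetricSpace.ofPreNNDist d hself hcomm, fun x y =>
    hd x y ▸ ⟨PseudoMetricSpace.dist_ofPreNNDist_le d hself hcomm x y,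
      PseudoMetricSpace.le_two_mul_dist_ofPreNNDist d hself hcomm htri x y⟩⟩

theorem isCoarseEmbedding_of_forall_exists {X H : Type*} [PseudoMetricSpace H] {d : X → X → ℝ}
    {f : X → H} (hup : ∀ R, ∃ S, ∀ x y, d x y ≤ R → dist (f x) (f y) ≤ S)
    (hlow : ∀ S, ∃ R, ∀ x y, R ≤ d x y → S ≤ dist (f x) (f y)) : IsCoarseEmbedding d f := by
  choose S hS using hup
  let B : ℝ → Set ℝ := fun r => {s | 0 ≤ s ∧ (r ≤ s ∨ ∃ x y, r ≤ d x y ∧ dist (f x) (f y) ≤ s)}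
  have hne (r : ℝ) : (B r).Nonempty := ⟨max r 0, le_max_right _ _, .inl (le_max_left _ _)⟩
  have hbdd (r : ℝ) : BddBelow (B r) := ⟨0, fun s hs => hs.1⟩
  refine ⟨fun r => sInf (B r), fun r => ∑ k ∈ Finset.range (⌈r⌉₊ + 1), |S k|, ?_, ?_, ?_, ?_⟩
  · intro r r' hr
    refine csInf_le_csInf (hbdd r) (hne r') ?_
    rintro s ⟨hs0, hs | ⟨x, y, hxy, hs⟩⟩
    · exact ⟨hs0, .inl (hr.trans hs)⟩
    · exact ⟨hs0, .inr ⟨x, y, hr.trans hxy, hs⟩⟩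
  · intro r r' hr
    refine Finset.sum_le_sum_of_subset_of_nonneg ?_ fun _ _ _ => abs_nonneg _
    gcongr
  · refine tendsto_atTop.2 fun s => ?_
    obtain ⟨R, hR⟩ := hlow s
    filter_upwards [eventually_ge_atTop (max R s)] with r hr
    refine le_csInf (hne r) ?_
    rintro t ⟨-, ht | ⟨x, y, hxy, ht⟩⟩
    · exact (le_max_right _ _).trans (hr.trans ht)
    · exact (hR x y ((le_max_left _ _).trans (hr.trans hxy))).trans ht
  · refine fun x y => ⟨csInf_le (hbdd _) ⟨dist_nonneg, .inr ⟨x, y, le_rfl, le_rfl⟩⟩, ?_⟩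
    refine (hS ⌈d x y⌉₊ x y (Nat.le_ceil _)).trans ((le_abs_self _).trans ?_)
    exact Finset.single_le_sum (f := fun k : ℕ => |S k|) (fun _ _ => abs_nonneg _)
      (Finset.self_mem_range_succ _)

/-- A uniformly continuous map on a quasi-normed space is bounded on bounded distances. -/
theorem IsQuasiNorm.exists_dist_le_of_uniform {X H : Type*} [AddCommGroup X] [Module ℝ X]
    [PseudoMetricSpace H] {q : X → ℝ} (hq : IsQuasiNorm q) {f : X → H}
    (hf : ∀ ε > 0, ∃ δ > 0, ∀ x y, q (x - y) < δ → dist (f x) (f y) < ε) (R : ℝ) :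
    ∃ S, ∀ x y, q (x - y) ≤ R → dist (f x) (f y) ≤ S := by
  obtain ⟨δ, hδ0, hδ⟩ := hf 1 one_pos
  obtain ⟨N, hN⟩ := exists_nat_gt (R / δ)
  refine ⟨(N + 1 : ℕ), fun x y hxy => ?_⟩
  let z : ℕ → X := fun k => x + ((k : ℝ) / (N + 1 : ℕ)) • (y - x)
  have hz0 : z 0 = x := by simp [z]
  have hzN : z (N + 1) = y := by
    simp only [z]
    rw [div_self (by positivity), one_smul, add_sub_cancel]
  have hstep (k : ℕ) : dist (f (z k)) (f (z (k + 1))) ≤ 1 := by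
    refine (hδ _ _ ?_).le
    have : z k - z (k + 1) = (1 / ((N + 1 : ℕ) : ℝ)) • (x - y) := by
      simp only [z]
      push_cast
      rw [add_div]
      module
    rw [this, hq.smul, abs_of_pos (by positivity), div_mul_eq_mul_div, one_mul,
      div_lt_iff₀ (by positivity)]
    rw [div_lt_iff₀ hδ0] at hN
    push_cast
    linarith
  have h := dist_le_range_sum_dist (fun k => f (z k)) (N + 1)
  rw [hz0, hzN] at h
  refine h.trans ((Finset.sum_le_sum fun k _ => hstep k).trans ?_)
  simp

theorem InfDimHilbertSpace.nontrivial (H : InfDimHilbertSpace) : Nontrivial H.carrier := by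
  by_contra h
  rw [not_nontrivial_iff_subsingleton] at h
  exact H.infdim inferInstance

theorem coarselyEmbedsIntoHilbert_of_uniformlyEmbedsIntoHilbert {X : Type*} [AddCommGroup X]
    [Module ℝ X] {q : X → ℝ} (hq : IsQuasiNorm q) (h : UniformlyEmbedsIntoHilbert X q) :
    CoarselyEmbedsIntoHilbert X q := by
  obtain ⟨H, f, -, hf, hinv⟩ := h
  beta_reduce at hf hinv
  have := H.nontrivial
  choose S hS using hq.exists_dist_le_of_uniform hf
  choose δ hδ0 hδ using fun n : ℕ => hf ((1 / 2) ^ n) (by positivity)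
  let s : ℕ → ℝ := fun n => δ n / (n + 1)
  have hs (n : ℕ) : 0 < s n := div_pos (hδ0 n) (by positivity)
  have hqs (n : ℕ) (x y : X) : q (s n • x - s n • y) = s n * q (x - y) := by
    rw [← smul_sub, hq.smul, abs_of_pos (hs n)]
  let F : ℕ → X → H.carrier := fun n x => f (s n • x)
  let b : ℝ → ℕ → ℝ := fun R n => (1 / 4) ^ n + if n < ⌈R⌉₊ then S (s n * R) ^ 2 else 0
  have hb (R : ℝ) : Summable (b R) := by
    refine (summable_geometric_of_lt_one (by norm_num) (by norm_num)).add
      (summable_of_ne_finset_zero (s := Finset.range ⌈R⌉₊) fun n hn => ?_)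
    rw [Finset.mem_range] at hn
    exact if_neg hn
  have hFb (R : ℝ) (x y : X) (hxy : q (x - y) ≤ R) (n : ℕ) : ‖F n x - F n y‖ ^ 2 ≤ b R n := by
    rw [← dist_eq_norm]
    by_cases hn : n < ⌈R⌉₊
    · have h1 : dist (F n x) (F n y) ≤ S (s n * R) := hS _ _ _ <| by
        rw [hqs]
        exact mul_le_mul_of_nonneg_left hxy (hs n).le
      have h2 : dist (F n x) (F n y) ^ 2 ≤ S (s n * R) ^ 2 := by gcongr
      simp only [b, if_pos hn]
      linarith [pow_pos (by norm_num : (0 : ℝ) < 1 / 4) n]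
    · have h1 : dist (F n x) (F n y) < (1 / 2) ^ n := hδ n _ _ <| by
        rw [hqs, div_mul_eq_mul_div, div_lt_iff₀ (by positivity)]
        refine mul_lt_mul_of_pos_left ?_ (hδ0 n)
        have h3 : R ≤ n := Nat.ceil_le.1 (not_lt.1 hn)
        linarith
      have h2 : dist (F n x) (F n y) ^ 2 ≤ ((1 / 2) ^ n) ^ 2 := by gcongr
      simp only [b, if_neg hn, add_zero]
      refine h2.trans_eq ?_
      rw [← pow_mul, mul_comm, pow_mul]
      norm_num
  obtain ⟨G, hG⟩ := exists_lp_map F fun x y =>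
    (hb (q (x - y))).of_nonneg_of_le (fun n => sq_nonneg _) (hFb _ x y le_rfl)
  refine ⟨⟨lp (fun _ : ℕ => H.carrier) 2, not_finiteDimensional_lp _⟩, G,
    isCoarseEmbedding_of_forall_exists (fun R => ⟨√(∑' n, b R n), fun x y hxy => ?_⟩) fun T => ?_⟩
  · rw [dist_eq_norm]
    exact Real.le_sqrt_of_sq_le (hasSum_le (hFb R x y hxy) (hG x y) (hb R).hasSum)
  · obtain ⟨η, hη0, hη⟩ := hinv 1 one_pos
    obtain ⟨N, hN⟩ := exists_nat_ge (T ^ 2 / η ^ 2)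
    refine ⟨∑ k ∈ Finset.range N, 1 / s k, fun x y hxy => ?_⟩
    rw [dist_eq_norm]
    refine abs_le_of_sq_le_sq' ?_ (norm_nonneg _) |>.2
    have hterm (k : ℕ) (hk : k ∈ Finset.range N) : η ^ 2 ≤ ‖F k x - F k y‖ ^ 2 := by
      have h1 : 1 / s k ≤ q (x - y) := (Finset.single_le_sum (f := fun k => 1 / s k)
        (fun k _ => (one_div_pos.2 (hs k)).le) hk).trans hxy
      have h2 : η ≤ ‖F k x - F k y‖ := by
        by_contra! hlt
        have h3 := hη (s k • x) (s k • y) (by rwa [dist_eq_norm])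
        rw [hqs] at h3
        rw [div_le_iff₀ (hs k)] at h1
        linarith
      gcongr
    calc T ^ 2 ≤ N * η ^ 2 := (div_le_iff₀ (by positivity)).1 hN
      _ = ∑ k ∈ Finset.range N, η ^ 2 := by simp
      _ ≤ ∑ k ∈ Finset.range N, ‖F k x - F k y‖ ^ 2 := Finset.sum_le_sum hterm
      _ ≤ _ := sum_le_hasSum _ (fun _ _ => sq_nonneg _) (hG x y)

theorem uniformlyEmbedsIntoHilbert_of_coarselyEmbedsIntoHilbert {X : Type*} [AddCommGroup X]
    [Module ℝ X] {q : X → ℝ} (hq : IsQuasiNorm q) (h : CoarselyEmbedsIntoHilbert X q) :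
    UniformlyEmbedsIntoHilbert X q := by
  obtain ⟨H, f, φ₁, φ₂, hφ₁, hφ₂, hφ, hf⟩ := h
  obtain ⟨p, hp0, hp1, m, hm⟩ := exists_pseudoMetric_of_isQuasiNorm hq
  have hup (R : ℝ) : ∃ S, ∀ x y, dist x y ≤ R → ‖f x - f y‖ ≤ S := by
    refine ⟨φ₂ ((2 * R) ^ p⁻¹), fun x y hxy => ?_⟩
    rw [← dist_eq_norm]
    refine (hf x y).2.trans (hφ₂ ?_)
    rw [Real.le_rpow_inv_iff_of_pos (hq.nonneg _) (by linarith [@dist_nonneg X m x y]) hp0]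
    linarith [(hm x y).2]
  have hlow (S : ℝ) : ∃ R, ∀ x y, R ≤ dist x y → S ≤ ‖f x - f y‖ := by
    obtain ⟨r, hr⟩ := eventually_atTop.1 (tendsto_atTop.1 hφ S)
    refine ⟨|r| ^ p, fun x y hxy => ?_⟩
    rw [← dist_eq_norm]
    refine (hr _ ?_).trans (hf x y).1
    exact (le_abs_self r).trans <|
      (Real.rpow_le_rpow_iff (abs_nonneg r) (hq.nonneg _) hp0).1 (hxy.trans (hm x y).1)
  obtain ⟨H', _, _, _, g, hg, R, hR⟩ := exists_holder_half_of_coarse f hup hlow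
  rcases subsingleton_or_nontrivial X with hX | hX
  · refine ⟨H, fun _ => 0, Function.injective_of_subsingleton _,
      fun ε hε => ⟨1, one_pos, fun _ _ _ => by simpa using hε⟩,
      fun ε hε => ⟨1, one_pos, fun x y _ => ?_⟩⟩
    beta_reduce
    rwa [Subsingleton.elim x y, sub_self, (hq.eq_zero_iff 0).2 rfl]
  have hqs (n : ℕ) (x y : X) : q ((2 : ℝ) ^ n • x - (2 : ℝ) ^ n • y) = 2 ^ n * q (x - y) := by
    rw [← smul_sub, hq.smul, abs_of_pos (by positivity)]
  have hfar (ε : ℝ) (hε : 0 < ε) : ∃ n : ℕ, ∀ x y, ε ≤ q (x - y) →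
      1 / 2 ≤ ‖g ((2 : ℝ) ^ n • x) - g ((2 : ℝ) ^ n • y)‖ := by
    obtain ⟨n, hn⟩ := pow_unbounded_of_one_lt ((2 * |R|) ^ p⁻¹ / ε) one_lt_two
    refine ⟨n, fun x y hxy => hR _ _ ?_⟩
    have h1 : (2 * |R|) ^ p⁻¹ ≤ 2 ^ n * q (x - y) :=
      ((div_lt_iff₀ hε).1 hn).le.trans (by gcongr)
    rw [Real.rpow_inv_le_iff_of_pos (by positivity)
      (mul_nonneg (by positivity) (hq.nonneg _)) hp0, ← hqs] at h1
    linarith [(hm ((2 : ℝ) ^ n • x) ((2 : ℝ) ^ n • y)).2, le_abs_self R]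
  have : Nontrivial H' := by
    obtain ⟨x, hx⟩ := exists_ne (0 : X)
    have hx0 : 0 < q x := (hq.nonneg x).lt_of_ne' fun h => hx ((hq.eq_zero_iff x).1 h)
    obtain ⟨n, hn⟩ := hfar (q x) hx0
    refine ⟨g ((2 : ℝ) ^ n • x), g ((2 : ℝ) ^ n • 0), fun h => ?_⟩
    have := hn x 0 (by rw [sub_zero])
    rw [h, sub_self, norm_zero] at this
    norm_num at this
  let F : ℕ → X → H' := fun n x => (1 / 2 : ℝ) ^ n • g ((2 : ℝ) ^ n • x)
  have hF (n : ℕ) (x y : X) : ‖F n x - F n y‖ =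
      (1 / 2) ^ n * ‖g ((2 : ℝ) ^ n • x) - g ((2 : ℝ) ^ n • y)‖ := by
    simp only [F]
    rw [← smul_sub, norm_smul, Real.norm_of_nonneg (by positivity)]
  have hFle (x y : X) (n : ℕ) : ‖F n x - F n y‖ ^ 2 ≤ (1 / 2) ^ n * q (x - y) ^ p := by
    have hqp : 0 ≤ q (x - y) ^ p := Real.rpow_nonneg (hq.nonneg _) _
    have h1 : dist ((2 : ℝ) ^ n • x) ((2 : ℝ) ^ n • y) ≤ 2 ^ n * q (x - y) ^ p := by
      refine (hm _ _).1.trans ?_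
      rw [hqs, Real.mul_rpow (by positivity) (hq.nonneg _)]
      gcongr
      exact Real.rpow_le_self_of_one_le (one_le_pow₀ one_le_two) hp1
    rw [hF, mul_pow]
    calc ((1 / 2 : ℝ) ^ n) ^ 2 * ‖g ((2 : ℝ) ^ n • x) - g ((2 : ℝ) ^ n • y)‖ ^ 2
        ≤ ((1 / 2 : ℝ) ^ n) ^ 2 * (2 ^ n * q (x - y) ^ p) := by
          gcongr
          have := hg ((2 : ℝ) ^ n • x) ((2 : ℝ) ^ n • y)
          have h0 := @dist_nonneg X m ((2 : ℝ) ^ n • x) ((2 : ℝ) ^ n • y)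
          linarith
      _ = (1 / 2) ^ n * q (x - y) ^ p := by
          rw [sq, mul_assoc, ← mul_assoc (_ ^ n) (2 ^ n), ← mul_pow]
          norm_num
  have hsum (x y : X) : HasSum (fun n : ℕ => (1 / 2 : ℝ) ^ n * q (x - y) ^ p)
      (2 * q (x - y) ^ p) := hasSum_geometric_two.mul_right _
  obtain ⟨G, hG⟩ := exists_lp_map F fun x y =>
    (hsum x y).summable.of_nonneg_of_le (fun n => sq_nonneg _) (hFle x y)
  have hinv (ε : ℝ) (hε : 0 < ε) : ∃ δ > 0, ∀ x y, dist (G x) (G y) < δ → q (x - y) < ε := by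
    obtain ⟨n, hn⟩ := hfar ε hε
    refine ⟨(1 / 2) ^ n * (1 / 2), by positivity, fun x y hxy => ?_⟩
    by_contra! hlt
    refine hxy.not_ge ?_
    have h1 : ‖F n x - F n y‖ ^ 2 ≤ ‖G x - G y‖ ^ 2 :=
      le_hasSum (hG x y) n fun _ _ => sq_nonneg _
    rw [dist_eq_norm]
    refine le_trans ?_ (pow_le_pow_iff_left₀ (norm_nonneg _) (norm_nonneg _) two_ne_zero |>.1 h1)
    rw [hF]
    gcongr
    exact hn x y hlt
  refine ⟨⟨lp (fun _ : ℕ => H') 2, not_finiteDimensional_lp _⟩, G, fun x y hxy => ?_,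
    fun ε hε => ⟨(ε ^ 2 / 2) ^ p⁻¹, by positivity, fun x y hxy => ?_⟩, hinv⟩
  · refine sub_eq_zero.1 ((hq.eq_zero_iff _).1 (le_antisymm ?_ (hq.nonneg _)))
    refine le_of_forall_pos_lt_add fun ε hε => ?_
    obtain ⟨δ, hδ, h⟩ := hinv ε hε
    rw [zero_add]
    exact h x y (by rwa [hxy, dist_self])
  · rw [dist_eq_norm]
    have h1 : q (x - y) ^ p < ε ^ 2 / 2 :=
      (Real.lt_rpow_inv_iff_of_pos (hq.nonneg _) (by positivity) hp0).1 hxy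
    refine lt_of_pow_lt_pow_left₀ 2 hε.le ?_
    exact (hasSum_le (hFle x y) (hG x y) (hsum x y)).trans_lt (by linarith)

/-- A quasi-Banach space uniformly embeds into a real, infinite-dimensional Hilbert space
if and only if it coarsely embeds into such a Hilbert space. -/
theorem quasiBanach_uniformEmbeds_iff_coarseEmbeds_hilbert
    (X : Type*) [AddCommGroup X] [Module ℝ X] (q : X → ℝ)
    (hq : IsQuasiNorm q) (hcomplete : QuasiNormComplete q) :
    UniformlyEmbedsIntoHilbert X q ↔ CoarselyEmbedsIntoHilbert X q :=
  ⟨coarselyEmbedsIntoHilbert_of_uniformlyEmbedsIntoHilbert hq,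
    uniformlyEmbedsIntoHilbert_of_coarselyEmbedsIntoHilbert hq⟩
end

section
/- Let X be a quasi-Banach space, (Ω, 𝔅, μ) a probability space, and U : X → L₀(μ) a continuous linear operator. Suppose there are a function g : X → ℝ and a nondecreasing φ₁ : [0,∞) → [0,∞) with φ₁(t) → ∞ as t → ∞, such that φ₁(‖x‖) ≤ g(x) for all x ∈ X, and such that the characteristic function of Ux satisfies 𝔼[exp(i t Ux)] = e^{−g(tx)} for every x ∈ X and t ∈ ℝ. Then for every sequence (xₙ) in X, if Uxₙ → 0 in measure then xₙ → 0 in X; consequently U is injective and its inverse, defined on the image of U, is continuous, so U is a linear isomorphism of X onto a subspace of L₀(μ). -/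
open Filter Function

/-- Convergence to `0` in measure implies pointwise convergence of characteristic functions
to `1`. -/
theorem MeasureTheory.TendstoInMeasure.tendsto_integral_cexp
    {Ω : Type*} [MeasurableSpace Ω] {μ : MeasureTheory.Measure Ω}
    [MeasureTheory.IsProbabilityMeasure μ] {h : ℕ → Ω → ℝ} (hmeas : ∀ n, Measurable (h n))
    (hh : MeasureTheory.TendstoInMeasure μ h atTop (0 : Ω → ℝ)) (t : ℝ) :
    Tendsto (fun n => ∫ ω, Complex.exp (Complex.I * (t : ℂ) * ((h n ω : ℝ) : ℂ)) ∂μ)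
      atTop (nhds 1) := by
  refine tendsto_of_subseq_tendsto fun ns hns => ?_
  have hsub : MeasureTheory.TendstoInMeasure μ (fun n => h (ns n)) atTop (0 : Ω → ℝ) :=
    fun ε hε => (hh ε hε).comp hns
  obtain ⟨ms, -, hae⟩ := hsub.exists_seq_tendsto_ae
  refine ⟨ms, ?_⟩
  have hone : (1 : ℂ) = ∫ _, (1 : ℂ) ∂μ := by simp
  rw [hone]
  refine MeasureTheory.tendsto_integral_of_dominated_convergence (fun _ => (1 : ℝ))
    (fun n => ?_) (MeasureTheory.integrable_const _) (fun n => ?_) ?_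
  · have := hmeas (ns (ms n))
    exact Measurable.aestronglyMeasurable (by fun_prop)
  · refine Eventually.of_forall fun ω => le_of_eq ?_
    rw [Complex.norm_exp]
    simp
  · filter_upwards [hae] with ω hω
    have hcont : Continuous fun y : ℝ => Complex.exp (Complex.I * (t : ℂ) * (y : ℂ)) := by
      fun_prop
    simpa [Function.comp_def] using (hcont.tendsto 0).comp hω

/-- Let `X` be a quasi-Banach space, `(Ω, 𝔅, μ)` a probability space, and
`U : X → L₀(μ)` a continuous linear operator such that the characteristic function of
`U x` satisfies `𝔼[exp (i t U x)] = exp (-g (t • x))`, where `φ₁(‖x‖) ≤ g x` for a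
nondecreasing `φ₁` tending to `∞`. Then `U xₙ → 0` in measure implies `xₙ → 0` in `X`;
consequently `U` is injective with continuous inverse on its image, i.e. `U` is a linear
isomorphism of `X` onto a subspace of `L₀(μ)`. -/
theorem linear_iso_onto_subspace_L0_of_char_bound
    (X : Type*) [AddCommGroup X] [Module ℝ X] (q : X → ℝ)
    (hq : IsQuasiNorm q) (hcomplete : QuasiNormComplete q)
    (Ω : Type*) [MeasurableSpace Ω] (μ : MeasureTheory.Measure Ω)
    [MeasureTheory.IsProbabilityMeasure μ]
    (U : X →ₗ[ℝ] (Ω → ℝ)) (hUmeas : ∀ x : X, Measurable (U x))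
    -- `U` is continuous from `X` to `L₀(μ)`
    (hUcont : ∀ u : ℕ → X, Tendsto (fun n => q (u n)) atTop (nhds 0) →
      MeasureTheory.TendstoInMeasure μ (fun n => U (u n)) atTop (0 : Ω → ℝ))
    (g : X → ℝ) (φ₁ : ℝ → ℝ) (hφ₁ : Monotone φ₁) (hφ₁top : Tendsto φ₁ atTop atTop)
    (hg : ∀ x : X, φ₁ (q x) ≤ g x)
    -- the characteristic function of `U x` is `exp (-g (t x))`
    (hchar : ∀ (x : X) (t : ℝ),
      (∫ ω, Complex.exp (Complex.I * (t : ℂ) * ((U x ω : ℝ) : ℂ)) ∂μ)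
        = Complex.exp (-(g (t • x) : ℂ))) :
    Function.Injective U ∧
      ∀ u : ℕ → X, MeasureTheory.TendstoInMeasure μ (fun n => U (u n)) atTop (0 : Ω → ℝ) →
        Tendsto (fun n => q (u n)) atTop (nhds 0) := by
  have hinv : ∀ u : ℕ → X,
      MeasureTheory.TendstoInMeasure μ (fun n => U (u n)) atTop (0 : Ω → ℝ) →
        Tendsto (fun n => q (u n)) atTop (nhds 0) := by
    intro u hu
    obtain ⟨M, hM, hM0⟩ := ((hφ₁top.eventually_ge_atTop 1).and (eventually_gt_atTop 0)).exists
    rw [Metric.tendsto_atTop']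
    intro ε hε
    have hlim := hu.tendsto_integral_cexp (fun n => hUmeas (u n)) (M / ε)
    simp only [hchar] at hlim
    have hnorm := hlim.norm
    simp only [Complex.norm_exp, Complex.neg_re, Complex.ofReal_re, norm_one] at hnorm
    have hlt : Real.exp (-1) < 1 := by simp
    obtain ⟨N, hN⟩ := eventually_atTop.1 (hnorm.eventually (lt_mem_nhds hlt))
    refine ⟨N, fun n hn => ?_⟩
    rw [Real.dist_eq, sub_zero, abs_of_nonneg (hq.nonneg _)]
    by_contra! hle
    have hg1 : g ((M / ε) • u n) < 1 := by
      have := Real.exp_lt_exp.1 (hN n hn.le)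
      linarith
    have hMle : M ≤ q ((M / ε) • u n) := by
      rw [hq.smul, abs_of_pos (div_pos hM0 hε)]
      calc M = M / ε * ε := by field_simp
        _ ≤ M / ε * q (u n) := by gcongr
    linarith [hφ₁ hMle, hg ((M / ε) • u n)]
  refine ⟨(injective_iff_map_eq_zero U).2 fun x hx => ?_, hinv⟩
  have hconst := hinv (fun _ => x) (by
    intro ε hε
    simp [hx, hε.ne'])
  exact (hq.eq_zero_iff x).1 (tendsto_nhds_unique tendsto_const_nhds hconst)
end
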